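/- Let A = 1/4, f(m) = Σ_{n≥0} (A^n/n!)² (−1)^n m^n, and χ(R,u) := e^{R/2} f(u² − R²) · 1_{u² ≤ R²}. For ψ a continuous function with compact support on ℝ, define η(R,u) := ∫_ℝ χ(R, u−s) ψ(s) ds. Then: (i) for every φ ∈ C_c^∞(ℝ²), ∬_{ℝ²} η(R,u) ( ∂_RR φ − ∂_uu φ + ∂_R φ )(R,u) dR du = 4 ∫_ℝ ψ(s) φ(0,s) ds; in particular η satisfies the entropy wave equation η_RR − η_uu − η_R = 0 in the sense of distributions on the open set {R ≠ 0}; (ii) for every u ∈ ℝ, η(R,u) → 0 as R → 0 and as R → −∞; (iii) for every u ∈ ℝ, ∂_R η(R,u) → +2 ψ(u) as R → 0+ and ∂_R η(R,u) → −2 ψ(u) as R → 0−. -/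

import Mathlib

open MeasureTheory Real Set Filter Topology

noncomputable section

/-- The function `f(m) = Σ_{n≥0} (A^n/n!)² (−1)^n m^n` with `A = 1/4`,
representable by the Bessel function of order zero. -/
def fker (m : ℝ) : ℝ :=
  ∑' n : ℕ, (((1 : ℝ) / 4) ^ n / (n.factorial : ℝ)) ^ 2 * (-1) ^ n * m ^ n

/-- The entropy kernel `χ(R,u) = e^{R/2} f(u² − R²) 1_{u² ≤ R²}` of the
isothermal Euler equations. -/
def chiKer (R u : ℝ) : ℝ :=
  if u ^ 2 ≤ R ^ 2 then Real.exp (R / 2) * fker (u ^ 2 - R ^ 2) else 0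

/-- The weak entropy `η(R,u) = ∫ χ(R, u−s) ψ(s) ds` generated by `ψ`. -/
def etaKer (ψ : ℝ → ℝ) (R u : ℝ) : ℝ := ∫ s : ℝ, chiKer R (u - s) * ψ s

theorem hasDerivAt_tsum_pow {c : ℕ → ℝ} (hc : ∀ n, |c n| ≤ 1 / (n.factorial : ℝ))
    (hc' : ∀ n, |(n + 1) * c (n + 1)| ≤ 1 / (n.factorial : ℝ)) (x : ℝ) :
    HasDerivAt (fun y => ∑' n, c n * y ^ n) (∑' n : ℕ, ((n + 1) * c (n + 1)) * x ^ n) x := by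
  have hsum : ∀ y : ℝ, Summable fun n => c n * y ^ n := fun y => by
    refine Summable.of_norm_bounded (Real.summable_pow_div_factorial |y|) fun n => ?_
    rw [norm_mul, norm_pow, Real.norm_eq_abs, Real.norm_eq_abs, div_eq_inv_mul, ← one_div]
    gcongr
    exact hc n
  have hshift : ∀ y : ℝ, ∑' n, c n * y ^ n = c 0 + ∑' n : ℕ, c (n + 1) * y ^ (n + 1) := fun y => by
    rw [(hsum y).tsum_eq_zero_add]; simp
  simp_rw [hshift]
  refine HasDerivAt.const_add _ ?_
  refine hasDerivAt_tsum_of_isPreconnected (t := Metric.ball 0 (|x| + 1)) (y₀ := 0)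
    (g := fun n y => c (n + 1) * y ^ (n + 1)) (g' := fun n y => (n + 1) * c (n + 1) * y ^ n)
    (Real.summable_pow_div_factorial (|x| + 1)) Metric.isOpen_ball
    (convex_ball (0 : ℝ) _).isPreconnected ?_ ?_ ?_ ?_ ?_
  · intro n y _
    have := (hasDerivAt_pow (n + 1) y).const_mul (c (n + 1))
    refine this.congr_deriv ?_
    push_cast
    ring
  · intro n y hy
    rw [norm_mul, norm_pow, Real.norm_eq_abs, Real.norm_eq_abs, div_eq_inv_mul, ← one_div]
    gcongr
    · exact hc' n
    · simpa using (mem_ball_zero_iff.1 hy).le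
  · exact Metric.mem_ball_self (by positivity)
  · simp
  · simp

/-- Taylor coefficients of `fker` at the origin. -/
def fkerCoeff (n : ℕ) : ℝ := (-1 / 16) ^ n / (n.factorial : ℝ) ^ 2

theorem fkerCoeff_succ (n : ℕ) :
    ((n : ℝ) + 1) ^ 2 * fkerCoeff (n + 1) = -1 / 16 * fkerCoeff n := by
  have : (n.factorial : ℝ) ≠ 0 := by positivity
  unfold fkerCoeff
  rw [Nat.factorial_succ]
  push_cast
  field_simp
  ring

theorem abs_fkerCoeff_le (n : ℕ) : |fkerCoeff n| ≤ 1 / (n.factorial : ℝ) := by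
  have h1 : (1 : ℝ) ≤ n.factorial := by exact_mod_cast n.factorial_pos
  unfold fkerCoeff
  rw [abs_div, abs_pow, abs_of_pos (by positivity : (0 : ℝ) < (n.factorial : ℝ) ^ 2)]
  gcongr
  · exact pow_le_one₀ (abs_nonneg _) (by norm_num [abs_div])
  · nlinarith

theorem abs_succ_mul_fkerCoeff_le (n : ℕ) :
    |((n : ℝ) + 1) * fkerCoeff (n + 1)| ≤ 1 / (n.factorial : ℝ) := by
  have h : ((n : ℝ) + 1) * fkerCoeff (n + 1) = -1 / 16 * fkerCoeff n / (n + 1) := by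
    rw [← fkerCoeff_succ]; field_simp
  have h2 := abs_fkerCoeff_le n
  rw [h, abs_div, abs_mul, abs_of_pos (by positivity : (0 : ℝ) < (n : ℝ) + 1)]
  refine (div_le_self (by positivity) (by linarith [Nat.cast_nonneg (α := ℝ) n])).trans ?_
  norm_num [abs_div]
  norm_num at h2
  nlinarith [abs_nonneg (fkerCoeff n)]

theorem fker_eq_tsum (m : ℝ) : fker m = ∑' n, fkerCoeff n * m ^ n := by
  unfold fker fkerCoeff
  refine tsum_congr fun n => ?_
  rw [div_pow, ← pow_mul, mul_comm n 2, pow_mul, div_mul_eq_mul_div, ← mul_pow]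
  norm_num

theorem summable_fker (m : ℝ) : Summable fun n => fkerCoeff n * m ^ n := by
  refine Summable.of_norm_bounded (Real.summable_pow_div_factorial |m|) fun n => ?_
  rw [norm_mul, norm_pow, Real.norm_eq_abs, Real.norm_eq_abs, div_eq_inv_mul, ← one_div]
  gcongr
  exact abs_fkerCoeff_le n

theorem fker_zero : fker 0 = 1 := by
  rw [fker_eq_tsum, tsum_eq_single 0]
  · simp [fkerCoeff]
  · intro n hn; simp [hn]

/-- The derivative of `fker`. -/
def fker₁ (m : ℝ) : ℝ := ∑' n : ℕ, ((n + 1) * fkerCoeff (n + 1)) * m ^ n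

/-- The second derivative of `fker`. -/
def fker₂ (m : ℝ) : ℝ :=
  ∑' n : ℕ, ((n + 1) * (((n + 1 : ℕ) + 1) * fkerCoeff (n + 1 + 1))) * m ^ n

theorem abs_fkerCoeff₂_le (n : ℕ) :
    |((n : ℝ) + 1) * (((n + 1 : ℕ) + 1) * fkerCoeff (n + 1 + 1))| ≤ 1 / (n.factorial : ℝ) := by
  have h := abs_succ_mul_fkerCoeff_le (n + 1)
  rw [abs_mul, abs_of_pos (by positivity : (0 : ℝ) < (n : ℝ) + 1)]
  calc _ ≤ ((n : ℝ) + 1) * (1 / ((n + 1).factorial : ℝ)) := by gcongr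
    _ = _ := by
      rw [Nat.factorial_succ]
      push_cast
      field_simp

theorem hasDerivAt_fker (m : ℝ) : HasDerivAt fker (fker₁ m) m := by
  have := hasDerivAt_tsum_pow abs_fkerCoeff_le abs_succ_mul_fkerCoeff_le m
  rwa [← funext fker_eq_tsum] at this

theorem hasDerivAt_fker₁ (m : ℝ) : HasDerivAt fker₁ (fker₂ m) m :=
  hasDerivAt_tsum_pow abs_succ_mul_fkerCoeff_le abs_fkerCoeff₂_le m

theorem fker_ode (m : ℝ) : m * fker₂ m + fker₁ m + fker m / 16 = 0 := by
  have s1 : Summable fun n : ℕ => ((n + 1) * fkerCoeff (n + 1)) * m ^ n := by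
    refine Summable.of_norm_bounded (Real.summable_pow_div_factorial |m|) fun n => ?_
    rw [norm_mul, norm_pow, Real.norm_eq_abs, Real.norm_eq_abs, div_eq_inv_mul, ← one_div]
    gcongr
    exact abs_succ_mul_fkerCoeff_le n
  have s2 : Summable fun n : ℕ =>
      ((n + 1) * (((n + 1 : ℕ) + 1) * fkerCoeff (n + 1 + 1))) * m ^ n := by
    refine Summable.of_norm_bounded (Real.summable_pow_div_factorial |m|) fun n => ?_
    rw [norm_mul, norm_pow, Real.norm_eq_abs, Real.norm_eq_abs, div_eq_inv_mul, ← one_div]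
    gcongr
    exact abs_fkerCoeff₂_le n
  have e1 : fker₁ m = fkerCoeff 1 +
      ∑' n : ℕ, (((n + 1 : ℕ) + 1) * fkerCoeff (n + 1 + 1)) * m ^ (n + 1) := by
    unfold fker₁
    rw [s1.tsum_eq_zero_add]; simp
  have e0 : fker m = 1 + ∑' n : ℕ, fkerCoeff (n + 1) * m ^ (n + 1) := by
    rw [fker_eq_tsum, (summable_fker m).tsum_eq_zero_add]; simp [fkerCoeff]
  have e2 : m * fker₂ m =
      ∑' n : ℕ, m * (((n + 1) * (((n + 1 : ℕ) + 1) * fkerCoeff (n + 1 + 1))) * m ^ n) := by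
    unfold fker₂; rw [tsum_mul_left]
  rw [e0, e1, e2]
  have t1 := (summable_nat_add_iff 1).2 s1
  have t0 := (summable_nat_add_iff 1).2 (summable_fker m)
  have key := ((s2.mul_left m).add t1).add (t0.div_const 16)
  have hz : ∑' n : ℕ, (m * (((n + 1) * (((n + 1 : ℕ) + 1) * fkerCoeff (n + 1 + 1))) * m ^ n)
      + (((n + 1 : ℕ) + 1) * fkerCoeff (n + 1 + 1)) * m ^ (n + 1)
      + fkerCoeff (n + 1) * m ^ (n + 1) / 16) = 0 := by
    rw [← tsum_zero (β := ℕ)]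
    refine tsum_congr fun n => ?_
    have := fkerCoeff_succ (n + 1)
    push_cast at this ⊢
    rw [pow_succ]
    linear_combination m ^ n * m * this
  rw [((s2.mul_left m).add t1).tsum_add (t0.div_const 16), (s2.mul_left m).tsum_add t1,
    tsum_div_const] at hz
  have h1 : fkerCoeff 1 = -1 / 16 := by simp [fkerCoeff]
  rw [h1]
  linarith

theorem continuous_fker : Continuous fker :=
  continuous_iff_continuousAt.2 fun m => (hasDerivAt_fker m).continuousAt

theorem continuous_fker₁ : Continuous fker₁ :=
  continuous_iff_continuousAt.2 fun m => (hasDerivAt_fker₁ m).continuousAt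

theorem hasDerivAt_integral_self_upper {k : ℝ → ℝ → ℝ} (hk : Continuous (Function.uncurry k))
    (x₀ : ℝ) : HasDerivAt (fun x => ∫ t in x₀..x, k x t) (k x₀ x₀) x₀ := by
  rw [hasDerivAt_iff_isLittleO, Asymptotics.isLittleO_iff]
  intro ε hε
  obtain ⟨δ, hδ, h⟩ := Metric.continuousAt_iff.1 (hk.continuousAt (x := (x₀, x₀))) ε hε
  filter_upwards [Metric.ball_mem_nhds x₀ hδ] with x hx
  have hi : IntervalIntegrable (k x) volume x₀ x :=
    (hk.comp (Continuous.prodMk_right x)).intervalIntegrable _ _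
  have e : (∫ t in x₀..x, k x t) - (∫ t in x₀..x₀, k x₀ t) - (x - x₀) • k x₀ x₀
      = ∫ t in x₀..x, (k x t - k x₀ x₀) := by
    rw [intervalIntegral.integral_sub hi intervalIntegrable_const]
    simp
  rw [e, Real.norm_eq_abs (x - x₀)]
  refine intervalIntegral.norm_integral_le_of_norm_le_const fun t ht => ?_
  have ht' : dist t x₀ ≤ dist x x₀ := by
    rw [Real.dist_eq, Real.dist_eq]
    exact abs_sub_left_of_mem_uIcc (uIoc_subset_uIcc ht)
  have := @h (x, t) (by
    rw [Prod.dist_eq]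
    exact max_lt hx (ht'.trans_lt hx))
  exact this.le

theorem hasDerivAt_integral_upper_param {k k' : ℝ → ℝ → ℝ}
    (hk : Continuous (Function.uncurry k)) (hk' : Continuous (Function.uncurry k'))
    (hd : ∀ x t, HasDerivAt (fun x => k x t) (k' x t) x) (a x₀ : ℝ) :
    HasDerivAt (fun x => ∫ t in a..x, k x t) ((∫ t in a..x₀, k' x₀ t) + k x₀ x₀) x₀ := by
  have hki : ∀ x b c, IntervalIntegrable (k x) volume b c := fun x b c =>
    (hk.comp (Continuous.prodMk_right x)).intervalIntegrable _ _
  have e : (fun x => ∫ t in a..x, k x t)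
      = fun x => (∫ t in a..x₀, k x t) + ∫ t in x₀..x, k x t := by
    funext x
    exact (intervalIntegral.integral_add_adjacent_intervals (hki _ _ _) (hki _ _ _)).symm
  rw [e]
  refine HasDerivAt.add ?_ (hasDerivAt_integral_self_upper hk x₀)
  obtain ⟨C, hC⟩ := ((isCompact_closedBall x₀ 1).prod
    (isCompact_uIcc (a := a) (b := x₀))).exists_bound_of_continuousOn hk'.continuousOn
  refine (intervalIntegral.hasDerivAt_integral_of_dominated_loc_of_deriv_le (F' := k')
    (bound := fun _ => C) (Metric.closedBall_mem_nhds x₀ one_pos) ?_ (hki _ _ _) ?_ ?_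
    intervalIntegrable_const ?_).2
  · exact Eventually.of_forall fun x =>
      (hk.comp (Continuous.prodMk_right x)).aestronglyMeasurable
  · exact (hk'.comp (Continuous.prodMk_right x₀)).aestronglyMeasurable
  · exact Eventually.of_forall fun t ht x hx => hC (x, t) ⟨hx, uIoc_subset_uIcc ht⟩
  · exact Eventually.of_forall fun t _ x _ => hd x t

/-- The Klein-Gordon solution generated by `ψ`, for `x ≥ 0`: the integral of
`fker (t² - x²) ψ (u - t)` over `|t| ≤ x`, folded onto `0 ≤ t ≤ x`. -/
def foldedKer (ψ : ℝ → ℝ) (u x : ℝ) : ℝ :=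
  ∫ t in (0 : ℝ)..x, fker (t ^ 2 - x ^ 2) * (ψ (u - t) + ψ (u + t))

/-- The derivative of `foldedKer`. -/
def foldedKerDeriv (ψ : ℝ → ℝ) (u x : ℝ) : ℝ :=
  (∫ t in (0 : ℝ)..x, -2 * x * fker₁ (t ^ 2 - x ^ 2) * (ψ (u - t) + ψ (u + t)))
    + (ψ (u - x) + ψ (u + x))

section

variable {ψ : ℝ → ℝ}

theorem hasDerivAt_foldedKer (hψ : Continuous ψ) (u x : ℝ) :
    HasDerivAt (foldedKer ψ u) (foldedKerDeriv ψ u x) x := by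
  have c0 := continuous_fker
  have c1 := continuous_fker₁
  have := hasDerivAt_integral_upper_param
    (k := fun x t => fker (t ^ 2 - x ^ 2) * (ψ (u - t) + ψ (u + t)))
    (k' := fun x t => -2 * x * fker₁ (t ^ 2 - x ^ 2) * (ψ (u - t) + ψ (u + t)))
    (by unfold Function.uncurry; fun_prop) (by unfold Function.uncurry; fun_prop)
    (fun x t => by
      have h := (hasDerivAt_fker (t ^ 2 - x ^ 2)).comp x
        (((hasDerivAt_pow 2 x).const_sub (t ^ 2)))
      refine (h.mul_const _).congr_deriv ?_
      norm_num
      ring_nf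
      simp) 0 x
  simp only [sub_self, fker_zero, one_mul] at this
  exact this

theorem foldedKer_zero (u : ℝ) : foldedKer ψ u 0 = 0 := intervalIntegral.integral_same

theorem foldedKerDeriv_zero (u : ℝ) : foldedKerDeriv ψ u 0 = 2 * ψ u := by
  rw [foldedKerDeriv, intervalIntegral.integral_same, sub_zero, add_zero, zero_add, two_mul]

theorem continuous_foldedKerDeriv (hψ : Continuous ψ) (u : ℝ) :
    Continuous (foldedKerDeriv ψ u) := by
  have c1 := continuous_fker₁
  refine Continuous.add ?_ (by fun_prop)
  exact intervalIntegral.continuous_parametric_intervalIntegral_of_continuous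
    (by unfold Function.uncurry; fun_prop) continuous_id

theorem continuous_foldedKer (hψ : Continuous ψ) (u : ℝ) : Continuous (foldedKer ψ u) :=
  continuous_iff_continuousAt.2 fun x => (hasDerivAt_foldedKer hψ u x).continuousAt

theorem etaKer_eq_foldedKer (hψ : Continuous ψ) (R u : ℝ) :
    etaKer ψ R u = exp (R / 2) * foldedKer ψ u |R| := by
  have c0 := continuous_fker
  have e1 : etaKer ψ R u = ∫ t, chiKer R t * ψ (u - t) := by
    unfold etaKer
    rw [← integral_sub_left_eq_self _ _ u]
    simp
  have e2 : (fun t => chiKer R t * ψ (u - t)) = (Icc (-|R|) |R|).indicator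
      (fun t => exp (R / 2) * (fker (t ^ 2 - |R| ^ 2) * ψ (u - t))) := by
    funext t
    have hiff : t ^ 2 ≤ R ^ 2 ↔ t ∈ Icc (-|R|) |R| := by
      rw [sq_le_sq, abs_le, mem_Icc]
    by_cases ht : t ^ 2 ≤ R ^ 2
    · rw [indicator_of_mem (hiff.1 ht), chiKer, if_pos ht, sq_abs, mul_assoc]
    · rw [indicator_of_notMem (fun h => ht (hiff.2 h)), chiKer, if_neg ht, zero_mul]
  have hr := abs_nonneg R
  generalize |R| = r at *
  rw [e1, e2, integral_indicator measurableSet_Icc, integral_Icc_eq_integral_Ioc,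
    ← intervalIntegral.integral_of_le (by linarith), intervalIntegral.integral_const_mul, foldedKer]
  congr 1
  have i1 : ∀ a b, IntervalIntegrable (fun t => fker (t ^ 2 - r ^ 2) * ψ (u - t)) volume a b :=
    fun a b => Continuous.intervalIntegrable (by fun_prop) a b
  have i2 : ∀ a b, IntervalIntegrable (fun t => fker (t ^ 2 - r ^ 2) * ψ (u + t)) volume a b :=
    fun a b => Continuous.intervalIntegrable (by fun_prop) a b
  rw [← intervalIntegral.integral_add_adjacent_intervals (i1 (-r) 0) (i1 0 r)]
  simp_rw [mul_add]
  rw [intervalIntegral.integral_add (i1 _ _) (i2 _ _), add_comm]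
  congr 1
  have := intervalIntegral.integral_comp_neg (a := 0) (b := r)
    (fun t => fker (t ^ 2 - r ^ 2) * ψ (u - t))
  simp only [neg_zero, neg_sq, sub_neg_eq_add] at this
  exact this.symm

theorem tendsto_etaKer_zero (hψ : Continuous ψ) (u : ℝ) :
    Tendsto (fun R => etaKer ψ R u) (𝓝 0) (𝓝 0) := by
  have c := continuous_foldedKer hψ u
  have : Continuous fun R => etaKer ψ R u := by
    simp_rw [etaKer_eq_foldedKer hψ]
    fun_prop
  have h := this.tendsto 0
  rwa [etaKer_eq_foldedKer hψ, abs_zero, foldedKer_zero, mul_zero] at h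

theorem tendsto_deriv_etaKer_right (hψ : Continuous ψ) (u : ℝ) :
    Tendsto (fun R => deriv (fun R' => etaKer ψ R' u) R) (𝓝[>] 0) (𝓝 (2 * ψ u)) := by
  have c := continuous_foldedKer hψ u
  have c' := continuous_foldedKerDeriv hψ u
  have hd : ∀ R, HasDerivAt (fun R => exp (R / 2) * foldedKer ψ u R)
      (exp (R / 2) * (1 / 2) * foldedKer ψ u R + exp (R / 2) * foldedKerDeriv ψ u R) R :=
    fun R => ((hasDerivAt_id' R).div_const 2).exp.mul (hasDerivAt_foldedKer hψ u R)
  have hlim : Tendsto (fun R => exp (R / 2) * (1 / 2) * foldedKer ψ u R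
      + exp (R / 2) * foldedKerDeriv ψ u R) (𝓝[>] 0) (𝓝 (2 * ψ u)) := by
    have hc : Continuous fun R => exp (R / 2) * (1 / 2) * foldedKer ψ u R
      + exp (R / 2) * foldedKerDeriv ψ u R := by fun_prop
    have h := hc.tendsto 0
    simp only [zero_div, exp_zero, foldedKer_zero, foldedKerDeriv_zero,
      mul_zero, zero_add, one_mul] at h
    exact h.mono_left nhdsWithin_le_nhds
  refine hlim.congr' ?_
  filter_upwards [self_mem_nhdsWithin] with R hR
  refine (((hd R).congr_of_eventuallyEq ?_).deriv).symm
  filter_upwards [lt_mem_nhds hR] with x hx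
  rw [etaKer_eq_foldedKer hψ, abs_of_pos hx]

theorem tendsto_deriv_etaKer_left (hψ : Continuous ψ) (u : ℝ) :
    Tendsto (fun R => deriv (fun R' => etaKer ψ R' u) R) (𝓝[<] 0) (𝓝 (-2 * ψ u)) := by
  have c := continuous_foldedKer hψ u
  have c' := continuous_foldedKerDeriv hψ u
  have hd : ∀ R, HasDerivAt (fun R => exp (R / 2) * foldedKer ψ u (-R))
      (exp (R / 2) * (1 / 2) * foldedKer ψ u (-R)
        + exp (R / 2) * (foldedKerDeriv ψ u (-R) * -1)) R :=
    fun R => ((hasDerivAt_id' R).div_const 2).exp.mul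
      ((hasDerivAt_foldedKer hψ u (-R)).comp R (hasDerivAt_neg R))
  have hlim : Tendsto (fun R => exp (R / 2) * (1 / 2) * foldedKer ψ u (-R)
      + exp (R / 2) * (foldedKerDeriv ψ u (-R) * -1)) (𝓝[<] 0) (𝓝 (-2 * ψ u)) := by
    have hc : Continuous fun R => exp (R / 2) * (1 / 2) * foldedKer ψ u (-R)
      + exp (R / 2) * (foldedKerDeriv ψ u (-R) * -1) := by fun_prop
    have h := hc.tendsto 0
    simp only [zero_div, exp_zero, neg_zero, foldedKer_zero, foldedKerDeriv_zero,
      mul_zero, zero_add, one_mul] at h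
    rw [show -2 * ψ u = 2 * ψ u * -1 by ring]
    exact h.mono_left nhdsWithin_le_nhds
  refine hlim.congr' ?_
  filter_upwards [self_mem_nhdsWithin] with R hR
  refine (((hd R).congr_of_eventuallyEq ?_).deriv).symm
  filter_upwards [gt_mem_nhds hR] with x hx
  rw [etaKer_eq_foldedKer hψ, abs_of_neg hx]

end

/-- The ratio `(2n choose n) / 4 ^ n`. -/
def centralRatio (n : ℕ) : ℝ := ((2 * n).factorial : ℝ) / (4 ^ n * (n.factorial : ℝ) ^ 2)

theorem centralRatio_nonneg (n : ℕ) : 0 ≤ centralRatio n := by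
  unfold centralRatio; positivity

theorem centralRatio_succ (n : ℕ) :
    centralRatio (n + 1) = centralRatio n * ((2 * n + 1) / (2 * n + 2)) := by
  unfold centralRatio
  rw [show 2 * (n + 1) = 2 * n + 1 + 1 by ring, Nat.factorial_succ, Nat.factorial_succ,
    Nat.factorial_succ]
  push_cast
  field_simp
  ring

theorem centralRatio_sq_mul_le (n : ℕ) : centralRatio n ^ 2 * (2 * n + 1) ≤ 1 := by
  induction n with
  | zero => simp [centralRatio]
  | succ n ih =>
    have h : ((2 * n + 1 : ℝ) / (2 * n + 2)) ^ 2 * (2 * n + 3) ≤ 2 * n + 1 := by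
      rw [div_pow, div_mul_eq_mul_div, div_le_iff₀ (by positivity)]
      have : (0 : ℝ) ≤ n := n.cast_nonneg
      nlinarith
    rw [centralRatio_succ]
    push_cast
    nlinarith [sq_nonneg (centralRatio n)]

theorem tendsto_centralRatio : Tendsto centralRatio atTop (𝓝 0) := by
  have h : Tendsto (fun n : ℕ => √(1 / ((n : ℝ) + 1))) atTop (𝓝 0) := by
    simpa using (tendsto_one_div_add_atTop_nhds_zero_nat (𝕜 := ℝ)).sqrt
  refine squeeze_zero centralRatio_nonneg (fun n => ?_) h
  refine Real.le_sqrt_of_sq_le ?_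
  rw [le_div_iff₀ (by positivity)]
  refine le_trans ?_ (centralRatio_sq_mul_le n)
  gcongr
  linarith [n.cast_nonneg (α := ℝ)]

theorem fkerCoeff_mul_neg_pow (n : ℕ) (m : ℝ) :
    fkerCoeff n * (-m) ^ n = (m / 16) ^ n / (n.factorial : ℝ) ^ 2 := by
  rw [fkerCoeff, div_mul_eq_mul_div, ← mul_pow]
  ring_nf

theorem fker_neg_four_mul_sq_le {ε : ℝ} {N : ℕ} (hN : ∀ n ≥ N, centralRatio n ≤ ε)
    (hε : 0 ≤ ε) (x : ℝ) :
    fker (-(4 * x ^ 2)) ≤ ε * cosh x + ∑ n ∈ Finset.range N, x ^ (2 * n) := by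
  have hcosh := (Real.hasSum_cosh x).mul_left ε
  have hterm : ∀ n, fkerCoeff n * (-(4 * x ^ 2)) ^ n
      = centralRatio n * (x ^ (2 * n) / ((2 * n).factorial : ℝ)) := fun n => by
    rw [fkerCoeff_mul_neg_pow, centralRatio, pow_mul,
      show 4 * x ^ 2 / 16 = x ^ 2 / 4 by ring, div_pow]
    field_simp
  have hfin : HasSum (fun n => if n ∈ Finset.range N then x ^ (2 * n) else 0)
      (∑ n ∈ Finset.range N, x ^ (2 * n)) := by
    have := hasSum_sum_of_ne_finset_zero (L := .unconditional ℕ) (s := Finset.range N)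
      (f := fun n => if n ∈ Finset.range N then x ^ (2 * n) else 0) (fun n hn => if_neg hn)
    rwa [Finset.sum_congr rfl (fun n hn => if_pos hn)] at this
  rw [fker_eq_tsum]
  refine hasSum_le (fun n => ?_) (summable_fker _).hasSum (hcosh.add hfin)
  have hx : 0 ≤ x ^ (2 * n) := by rw [pow_mul]; positivity
  rw [hterm]
  by_cases hn : n ∈ Finset.range N
  · rw [if_pos hn]
    have h1 : centralRatio n ≤ 1 := by
      have := centralRatio_sq_mul_le n
      have h0 := centralRatio_nonneg n
      by_contra! hlt
      have : (0 : ℝ) ≤ n := n.cast_nonneg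
      nlinarith
    have h2 : x ^ (2 * n) / ((2 * n).factorial : ℝ) ≤ x ^ (2 * n) :=
      div_le_self hx (by exact_mod_cast (2 * n).factorial_pos)
    have h3 : 0 ≤ x ^ (2 * n) / ((2 * n).factorial : ℝ) := by positivity
    nlinarith [centralRatio_nonneg n, mul_nonneg hε h3]
  · rw [if_neg hn, add_zero]
    exact mul_le_mul_of_nonneg_right (hN n (by simpa using hn)) (by positivity)

theorem abs_fker_le {m M : ℝ} (hm : m ≤ 0) (hM : -M ≤ m) : |fker m| ≤ fker (-M) := by
  rw [fker_eq_tsum, fker_eq_tsum, ← Real.norm_eq_abs]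
  refine tsum_of_norm_bounded (summable_fker (-M)).hasSum fun n => ?_
  rw [fkerCoeff_mul_neg_pow, show m = -(-m) by ring, fkerCoeff_mul_neg_pow, Real.norm_of_nonneg]
  · gcongr
    · linarith
    · linarith
  · have : 0 ≤ -m / 16 := by linarith
    positivity

theorem abs_chiKer_le (R v : ℝ) : |chiKer R v| ≤ exp (R / 2) * fker (-R ^ 2) := by
  have h0 : 0 ≤ fker (-R ^ 2) :=
    (abs_nonneg _).trans (abs_fker_le le_rfl (by nlinarith [sq_nonneg R]))
  unfold chiKer
  split_ifs with h
  · rw [abs_mul, abs_exp]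
    gcongr
    exact abs_fker_le (by linarith) (by nlinarith [sq_nonneg v])
  · rw [abs_zero]; positivity

theorem tendsto_exp_neg_mul_fker :
    Tendsto (fun x => exp (-x) * fker (-(4 * x ^ 2))) atTop (𝓝 0) := by
  rw [Metric.tendsto_nhds]
  intro ε hε
  obtain ⟨N, hN⟩ := eventually_atTop.1 (tendsto_centralRatio.eventually_le_const (half_pos hε))
  have hpoly : Tendsto (fun x => ∑ n ∈ Finset.range N, x ^ (2 * n) * exp (-x)) atTop (𝓝 0) := by
    have := tendsto_finsetSum (Finset.range N)
      (fun n _ => Real.tendsto_pow_mul_exp_neg_atTop_nhds_zero (2 * n))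
    simpa using this
  filter_upwards [hpoly.eventually_lt_const (half_pos hε), eventually_ge_atTop 0] with x hx hx0
  have hnn : 0 ≤ fker (-(4 * x ^ 2)) :=
    (abs_nonneg _).trans (abs_fker_le le_rfl (by nlinarith [sq_nonneg x]))
  rw [Real.dist_eq, sub_zero, abs_of_nonneg (by positivity)]
  have hc : exp (-x) * cosh x ≤ 1 := by
    rw [Real.cosh_eq, mul_div_assoc', mul_add, ← exp_add, ← exp_add]
    have : exp (-x + -x) ≤ 1 := exp_le_one_iff.2 (by linarith)
    simp only [neg_add_cancel, exp_zero]
    linarith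
  calc exp (-x) * fker (-(4 * x ^ 2))
      ≤ exp (-x) * (ε / 2 * cosh x + ∑ n ∈ Finset.range N, x ^ (2 * n)) := by
        gcongr; exact fker_neg_four_mul_sq_le hN (half_pos hε).le x
    _ = ε / 2 * (exp (-x) * cosh x) + ∑ n ∈ Finset.range N, x ^ (2 * n) * exp (-x) := by
        rw [← Finset.sum_mul]; ring
    _ < ε := by nlinarith

theorem tendsto_etaKer_atBot {ψ : ℝ → ℝ} (hψ : Continuous ψ) (hψs : HasCompactSupport ψ) (u : ℝ) :
    Tendsto (fun R => etaKer ψ R u) atBot (𝓝 0) := by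
  have hi : Integrable ψ := hψ.integrable_of_hasCompactSupport hψs
  have hlim : Tendsto (fun R : ℝ => exp (R / 2) * fker (-R ^ 2)) atBot (𝓝 0) := by
    have h : Tendsto (fun R : ℝ => -R / 2) atBot atTop :=
      tendsto_neg_atBot_atTop.atTop_div_const two_pos
    convert tendsto_exp_neg_mul_fker.comp h using 2 with R
    simp only [Function.comp]
    ring_nf
  refine squeeze_zero_norm (fun R => ?_) (by simpa using hlim.mul_const (∫ s, ‖ψ s‖))
  unfold etaKer
  rw [← integral_const_mul]
  refine norm_integral_le_of_norm_le (hi.norm.const_mul _) (Eventually.of_forall fun s => ?_)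
  rw [norm_mul]
  exact mul_le_mul_of_nonneg_right (abs_chiKer_le R (u - s)) (norm_nonneg _)

theorem fderiv_apply_fst {F : ℝ × ℝ → ℝ} {p : ℝ × ℝ} {v : ℝ} (hF : DifferentiableAt ℝ F p)
    (h : HasDerivAt (fun a => F (a, p.2)) v p.1) : fderiv ℝ F p (1, 0) = v := by
  have := hF.hasFDerivAt.comp_hasDerivAt p.1
    (((hasDerivAt_id' p.1).prodMk (hasDerivAt_const p.1 p.2)))
  exact this.unique h

theorem fderiv_apply_snd {F : ℝ × ℝ → ℝ} {p : ℝ × ℝ} {v : ℝ} (hF : DifferentiableAt ℝ F p)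
    (h : HasDerivAt (fun b => F (p.1, b)) v p.2) : fderiv ℝ F p (0, 1) = v := by
  have := hF.hasFDerivAt.comp_hasDerivAt p.2
    (((hasDerivAt_const p.2 p.1).prodMk (hasDerivAt_id' p.2)))
  exact this.unique h

/-- Green's identity for the Goursat problem in the first quadrant: the Riemann function
`fker (-4ab)` tested against the Klein-Gordon operator `∂₁∂₂ - 1/4`. -/
theorem integral_quadrant_fker {Ψ Ψ₂ Ψ₁₂ : ℝ × ℝ → ℝ} (hΨ : ContDiff ℝ 1 Ψ)
    (hΨ₂ : ContDiff ℝ 1 Ψ₂) (hΨ₁₂ : Continuous Ψ₁₂)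
    (d₂ : ∀ a b, HasDerivAt (fun b => Ψ (a, b)) (Ψ₂ (a, b)) b)
    (d₁₂ : ∀ a b, HasDerivAt (fun a => Ψ₂ (a, b)) (Ψ₁₂ (a, b)) a)
    (hs : HasCompactSupport Ψ) (hs₂ : HasCompactSupport Ψ₂) (hs₁₂ : HasCompactSupport Ψ₁₂) :
    ∫ p in Ioi (0 : ℝ) ×ˢ Ioi (0 : ℝ), fker (-4 * (p.1 * p.2)) * (Ψ₁₂ p - Ψ p / 4)
      = Ψ (0, 0) := by
  have c0 := continuous_fker
  have c1 := continuous_fker₁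
  have cd0 : Differentiable ℝ fker := fun m => (hasDerivAt_fker m).differentiableAt
  have cd1 : Differentiable ℝ fker₁ := fun m => (hasDerivAt_fker₁ m).differentiableAt
  have dΨ : Differentiable ℝ Ψ := hΨ.differentiable one_ne_zero
  have dΨ₂ : Differentiable ℝ Ψ₂ := hΨ₂.differentiable one_ne_zero
  have cΨ := hΨ.continuous
  have cΨ₂ := hΨ₂.continuous
  obtain ⟨M₀, hM₀, v₀⟩ := hs.exists_pos_le_norm
  obtain ⟨M₂, hM₂, v₂⟩ := hs₂.exists_pos_le_norm
  obtain ⟨M₁₂, hM₁₂, v₁₂⟩ := hs₁₂.exists_pos_le_norm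
  obtain ⟨M, m₀, m₂, m₁₂⟩ : ∃ M, M₀ ≤ M ∧ M₂ ≤ M ∧ M₁₂ ≤ M :=
    ⟨max M₀ (max M₂ M₁₂), by simp, by simp, by simp⟩
  have hM : 0 < M := hM₀.trans_le m₀
  have large : ∀ p : ℝ × ℝ, M ≤ p.1 ∨ M ≤ p.2 → M ≤ ‖p‖ := fun p hp => by
    rw [Prod.norm_def]
    rcases hp with h | h
    · exact le_max_of_le_left (h.trans (le_abs_self _))
    · exact le_max_of_le_right (h.trans (le_abs_self _))
  set H : ℝ × ℝ → ℝ := fun p => fker (-4 * (p.1 * p.2)) * (Ψ₁₂ p - Ψ p / 4) with hH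
  have cH : Continuous H := by fun_prop
  set P : ℝ × ℝ → ℝ := fun p => fker (-4 * (p.1 * p.2)) * Ψ₂ p with hP
  set Q : ℝ × ℝ → ℝ := fun p => 4 * p.2 * fker₁ (-4 * (p.1 * p.2)) * Ψ p with hQ
  have dP : Differentiable ℝ P := by fun_prop
  have dQ : Differentiable ℝ Q := by fun_prop
  have hdiv : ∀ p, fderiv ℝ P p (1, 0) + fderiv ℝ Q p (0, 1) = H p := fun p => by
    obtain ⟨a, b⟩ := p
    have l1 : HasDerivAt (fun x : ℝ => -4 * (x * b)) (-4 * b) a := by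
      simpa using ((hasDerivAt_id' a).mul_const b).const_mul (-4 : ℝ)
    have l2 : HasDerivAt (fun y : ℝ => -4 * (a * y)) (-4 * a) b := by
      simpa using ((hasDerivAt_id' b).const_mul a).const_mul (-4 : ℝ)
    have h1 := ((hasDerivAt_fker (-4 * (a * b))).comp a l1).mul (d₁₂ a b)
    have h2 := (((hasDerivAt_id' b).const_mul 4).mul
        ((hasDerivAt_fker₁ (-4 * (a * b))).comp b l2)).mul (d₂ a b)
    rw [fderiv_apply_fst (p := (a, b)) (dP (a, b)) h1, fderiv_apply_snd (p := (a, b)) (dQ (a, b)) h2]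
    simp only [hH, Function.comp, Pi.mul_apply]
    linear_combination (4 * Ψ (a, b)) * fker_ode (-4 * (a * b))
  have green := integral2_divergence_prod_of_hasFDerivAt P Q (fderiv ℝ P) (fderiv ℝ Q) 0 0 M M
    dP.continuous.continuousOn dQ.continuous.continuousOn
    (fun x _ => (dP x).hasFDerivAt) (fun x _ => (dQ x).hasFDerivAt)
    (by
      simp_rw [hdiv]
      exact cH.continuousOn.integrableOn_compact (isCompact_uIcc.prod isCompact_uIcc))
  simp_rw [hdiv] at green
  have z1 : ∀ x, Q (x, M) = 0 := fun x => by
    simp only [hQ, v₀ (x, M) (m₀.trans (large _ (Or.inr le_rfl))), mul_zero]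
  have z2 : ∀ x, Q (x, 0) = 0 := fun x => by simp [hQ]
  have z3 : ∀ y, P (M, y) = 0 := fun y => by
    simp only [hP, v₂ (M, y) (m₂.trans (large _ (Or.inl le_rfl))), mul_zero]
  have z4 : ∀ y, P (0, y) = Ψ₂ (0, y) := fun y => by simp [hP, fker_zero]
  have ftc : ∫ y in (0 : ℝ)..M, Ψ₂ (0, y) = Ψ (0, M) - Ψ (0, 0) :=
    intervalIntegral.integral_eq_sub_of_hasDerivAt (fun y _ => d₂ 0 y)
      ((cΨ₂.comp (Continuous.prodMk_right 0)).intervalIntegrable _ _)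
  simp only [z1, z2, z3, z4, ftc, intervalIntegral.integral_zero,
    v₀ (0, M) (m₀.trans (large _ (Or.inr le_rfl)))] at green
  have box : ∫ p in Ioi (0 : ℝ) ×ˢ Ioi (0 : ℝ), H p = ∫ p in Ioc 0 M ×ˢ Ioc 0 M, H p := by
    refine setIntegral_eq_of_subset_of_forall_sdiff_eq_zero
      (measurableSet_Ioi.prod measurableSet_Ioi)
      (prod_mono Ioc_subset_Ioi_self Ioc_subset_Ioi_self) fun p hp => ?_
    have : M ≤ p.1 ∨ M ≤ p.2 := by
      by_contra! h
      exact hp.2 ⟨⟨hp.1.1, h.1.le⟩, ⟨hp.1.2, h.2.le⟩⟩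
    have hp' := large p this
    simp [hH, v₀ p (m₀.trans hp'), v₁₂ p (m₁₂.trans hp')]
  rw [box, Measure.volume_eq_prod, setIntegral_prod]
  · simp_rw [intervalIntegral.integral_of_le hM.le] at green
    rw [green]; ring
  · rw [← Measure.volume_eq_prod]
    exact (cH.continuousOn.integrableOn_compact (isCompact_Icc.prod isCompact_Icc)).mono_set
      (prod_mono Ioc_subset_Icc_self Ioc_subset_Icc_self)

/-- Characteristic coordinates `(a, b) ↦ (a + b, s + a - b)` based at `(0, s)`. -/
def charCoord (s : ℝ) : ℝ × ℝ ≃ₜ ℝ × ℝ where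
  toFun p := (p.1 + p.2, s + p.1 - p.2)
  invFun q := ((q.1 + q.2 - s) / 2, (q.1 - q.2 + s) / 2)
  left_inv p := by ext <;> simp <;> ring
  right_inv q := by ext <;> simp <;> ring
  continuous_toFun := by fun_prop
  continuous_invFun := by fun_prop

theorem integral_comp_charCoord (s : ℝ) (F : ℝ × ℝ → ℝ) :
    ∫ p, F p = 2 * ∫ p, F (charCoord s p) := by
  let L : ℝ × ℝ →ₗ[ℝ] ℝ × ℝ :=
    (LinearMap.fst ℝ ℝ ℝ + LinearMap.snd ℝ ℝ ℝ).prod (LinearMap.fst ℝ ℝ ℝ - LinearMap.snd ℝ ℝ ℝ)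
  have hL : ∀ p, L p = (p.1 + p.2, p.1 - p.2) := fun p => rfl
  have hdet : LinearMap.det L = -2 := by
    rw [← LinearMap.det_toMatrix (Module.Basis.finTwoProd ℝ), Matrix.det_fin_two]
    simp [LinearMap.toMatrix_apply, hL]
    norm_num
  have hmap := Measure.map_linearMap_addHaar_eq_smul_addHaar (volume : Measure (ℝ × ℝ))
    (f := L) (by rw [hdet]; norm_num)
  have hLT : ∀ p, L p = charCoord 0 p := fun p => by
    simp [hL, charCoord]
  have h1 : ∫ p, F (charCoord s p) = ∫ p, (fun q => F (q + (0, s))) (charCoord 0 p) := by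
    refine integral_congr_ae (Eventually.of_forall fun p => ?_)
    change F (p.1 + p.2, s + p.1 - p.2) = F ((p.1 + p.2, 0 + p.1 - p.2) + (0, s))
    congr 1
    ext <;> simp
    ring
  have h2 := (charCoord 0).toMeasurableEquiv.measurableEmbedding.integral_map (μ := volume)
    (fun q => F (q + (0, s)))
  rw [show (⇑(charCoord 0).toMeasurableEquiv : ℝ × ℝ → ℝ × ℝ) = L from
    funext fun p => (hLT p).symm, hmap, hdet, integral_smul_measure,
    integral_add_right_eq_self] at h2
  rw [h1]
  simp_rw [← hLT]
  rw [← h2]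
  norm_num
  ring

/-- The function `e^{R/2} g` in characteristic coordinates based at `(0, s)`. -/
def charLift (s : ℝ) (g : ℝ × ℝ → ℝ) (p : ℝ × ℝ) : ℝ := exp ((p.1 + p.2) / 2) * g (charCoord s p)

/-- The derivative along `v` of `e^{R/2} g`, divided by `e^{R/2}`, when `v` has first
component `1`. -/
def twistedDeriv (v : ℝ × ℝ) (g : ℝ × ℝ → ℝ) (q : ℝ × ℝ) : ℝ := g q / 2 + fderiv ℝ g q v

section

variable {g : ℝ × ℝ → ℝ}

theorem contDiff_charLift {n : WithTop ℕ∞} (s : ℝ) (hg : ContDiff ℝ n g) :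
    ContDiff ℝ n (charLift s g) := by
  have : ContDiff ℝ n (charCoord s) := by
    change ContDiff ℝ n fun p : ℝ × ℝ => (p.1 + p.2, s + p.1 - p.2)
    fun_prop
  unfold charLift
  fun_prop

theorem continuous_charLift (s : ℝ) (hg : Continuous g) : Continuous (charLift s g) := by
  unfold charLift
  fun_prop

theorem hasCompactSupport_charLift (s : ℝ) (hg : HasCompactSupport g) :
    HasCompactSupport (charLift s g) :=
  (hg.comp_homeomorph (charCoord s)).mul_left

theorem contDiff_twistedDeriv (v : ℝ × ℝ) (hg : ContDiff ℝ (⊤ : ℕ∞) g) :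
    ContDiff ℝ (⊤ : ℕ∞) (twistedDeriv v g) := by
  have : ContDiff ℝ (⊤ : ℕ∞) (fderiv ℝ g) := hg.fderiv_right (by simp)
  unfold twistedDeriv
  fun_prop

theorem hasCompactSupport_twistedDeriv (v : ℝ × ℝ) (hg : HasCompactSupport g) :
    HasCompactSupport (twistedDeriv v g) :=
  (hg.comp_left (g := fun x => x / 2) (zero_div 2)).add (hg.fderiv_apply ℝ v)

theorem hasDerivAt_charLift_fst (s : ℝ) (hg : Differentiable ℝ g) (a b : ℝ) :
    HasDerivAt (fun a => charLift s g (a, b)) (charLift s (twistedDeriv (1, 1) g) (a, b)) a := by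
  have h1 : HasDerivAt (fun a => charCoord s (a, b)) (1, 1) a :=
    ((hasDerivAt_id' a).add_const b).prodMk (((hasDerivAt_id' a).const_add s).sub_const b)
  have h2 := (hg (charCoord s (a, b))).hasFDerivAt.comp_hasDerivAt a h1
  refine ((((hasDerivAt_id' a).add_const b).div_const 2).exp.mul h2).congr_deriv ?_
  simp only [charLift, twistedDeriv, Function.comp]
  ring

theorem hasDerivAt_charLift_snd (s : ℝ) (hg : Differentiable ℝ g) (a b : ℝ) :
    HasDerivAt (fun b => charLift s g (a, b)) (charLift s (twistedDeriv (1, -1) g) (a, b)) b := by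
  have h1 : HasDerivAt (fun b => charCoord s (a, b)) (1, -1) b :=
    ((hasDerivAt_id' b).const_add a).prodMk ((hasDerivAt_id' b).const_sub (s + a))
  have h2 := (hg (charCoord s (a, b))).hasFDerivAt.comp_hasDerivAt b h1
  refine ((((hasDerivAt_id' b).const_add a).div_const 2).exp.mul h2).congr_deriv ?_
  simp only [charLift, twistedDeriv, Function.comp]
  ring

end

/-- The formal adjoint `φ_RR - φ_uu + φ_R` of the entropy wave operator. -/
def adjointWave (φ : ℝ × ℝ → ℝ) (q : ℝ × ℝ) : ℝ :=
  fderiv ℝ (fun q => fderiv ℝ φ q (1, 0)) q (1, 0)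
    - fderiv ℝ (fun q => fderiv ℝ φ q (0, 1)) q (0, 1) + fderiv ℝ φ q (1, 0)

section

variable {φ : ℝ × ℝ → ℝ}

theorem adjointWave_eq_deriv (hφ : ContDiff ℝ (⊤ : ℕ∞) φ) (p : ℝ × ℝ) :
    deriv (fun R => deriv (fun R' => φ (R', p.2)) R) p.1
      - deriv (fun u => deriv (fun u' => φ (p.1, u')) u) p.2
      + deriv (fun R => φ (R, p.2)) p.1 = adjointWave φ p := by
  have hfst : ∀ {g : ℝ × ℝ → ℝ}, Differentiable ℝ g → ∀ R u,
      deriv (fun R => g (R, u)) R = fderiv ℝ g (R, u) (1, 0) := fun {g} hg R u =>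
    ((hg (R, u)).hasFDerivAt.comp_hasDerivAt R
      ((hasDerivAt_id' R).prodMk (hasDerivAt_const R u))).deriv
  have hsnd : ∀ {g : ℝ × ℝ → ℝ}, Differentiable ℝ g → ∀ R u,
      deriv (fun u => g (R, u)) u = fderiv ℝ g (R, u) (0, 1) := fun {g} hg R u =>
    ((hg (R, u)).hasFDerivAt.comp_hasDerivAt u
      ((hasDerivAt_const u R).prodMk (hasDerivAt_id' u))).deriv
  have hd : Differentiable ℝ φ := hφ.differentiable (by simp)
  have hd' : Differentiable ℝ (fderiv ℝ φ) :=
    (hφ.fderiv_right (m := (⊤ : ℕ∞)) (by simp)).differentiable (by simp)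
  have hv : ∀ v, Differentiable ℝ fun q => fderiv ℝ φ q v := fun v => by fun_prop
  simp_rw [hfst hd, hsnd hd]
  rw [hfst (hv _), hsnd (hv _), adjointWave]

theorem continuous_adjointWave (hφ : ContDiff ℝ (⊤ : ℕ∞) φ) : Continuous (adjointWave φ) := by
  have h : ∀ (g : ℝ × ℝ → ℝ) (v : ℝ × ℝ), ContDiff ℝ (⊤ : ℕ∞) g →
      ContDiff ℝ (⊤ : ℕ∞) fun q => fderiv ℝ g q v := fun g v hg => by
    have : ContDiff ℝ (⊤ : ℕ∞) (fderiv ℝ g) := hg.fderiv_right (by simp)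
    fun_prop
  exact ((h _ _ (h _ _ hφ)).continuous.sub (h _ _ (h _ _ hφ)).continuous).add
    (h _ _ hφ).continuous

theorem hasCompactSupport_adjointWave (hs : HasCompactSupport φ) :
    HasCompactSupport (adjointWave φ) :=
  (((hs.fderiv_apply ℝ _).fderiv_apply ℝ _).sub ((hs.fderiv_apply ℝ _).fderiv_apply ℝ _)).add
    (hs.fderiv_apply ℝ _)

theorem twistedDeriv_twistedDeriv_sub (hφ : ContDiff ℝ (⊤ : ℕ∞) φ) (q : ℝ × ℝ) :
    twistedDeriv (1, 1) (twistedDeriv (1, -1) φ) q - φ q / 4 = adjointWave φ q := by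
  have hd : Differentiable ℝ φ := hφ.differentiable (by simp)
  have hd' : Differentiable ℝ (fderiv ℝ φ) :=
    (hφ.fderiv_right (m := (⊤ : ℕ∞)) (by simp)).differentiable (by simp)
  have hv : ∀ v w, fderiv ℝ (fun q => fderiv ℝ φ q v) q w = fderiv ℝ (fderiv ℝ φ) q w v :=
    fun v w => by
      have := ((hd' q).hasFDerivAt.clm_apply (hasFDerivAt_const v q)).fderiv
      rw [this]; simp
  have hsymm : fderiv ℝ (fderiv ℝ φ) q (1, 0) (0, 1) = fderiv ℝ (fderiv ℝ φ) q (0, 1) (1, 0) :=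
    second_derivative_symmetric (fun y => (hd y).hasFDerivAt) (hd' q).hasFDerivAt _ _
  have e1 : ((1, 1) : ℝ × ℝ) = (1, 0) + (0, 1) := by simp
  have e2 : ((1, -1) : ℝ × ℝ) = (1, 0) - (0, 1) := by simp
  have h : fderiv ℝ (twistedDeriv (1, -1) φ) q (1, 1)
      = fderiv ℝ φ q (1, 1) / 2 + fderiv ℝ (fderiv ℝ φ) q (1, 1) (1, -1) := by
    rw [← hv]
    have a2 : DifferentiableAt ℝ (fun q => fderiv ℝ φ q (1, -1)) q := by fun_prop
    have e : twistedDeriv (1, -1) φ = fun q => 1 / 2 * φ q + fderiv ℝ φ q (1, -1) := by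
      funext q
      rw [twistedDeriv]
      ring
    rw [e, (((hd q).hasFDerivAt.const_mul (1 / 2)).fun_add a2.hasFDerivAt).fderiv]
    simp only [add_apply, smul_apply, smul_eq_mul]
    ring
  rw [twistedDeriv, h, twistedDeriv, adjointWave, hv, hv, e1, e2]
  simp only [map_add, map_sub, add_apply]
  rw [hsymm]
  ring

theorem chiKer_charCoord (s a b : ℝ) :
    chiKer (charCoord s (a, b)).1 ((charCoord s (a, b)).2 - s)
      = if 0 ≤ a * b then exp ((a + b) / 2) * fker (-4 * (a * b)) else 0 := by
  have h1 : (charCoord s (a, b)).1 = a + b := rfl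
  have h2 : (charCoord s (a, b)).2 - s = a - b := by
    change s + a - b - s = a - b
    ring
  rw [h1, h2, chiKer]
  have : (a - b) ^ 2 ≤ (a + b) ^ 2 ↔ 0 ≤ a * b := by
    constructor <;> intro h <;> nlinarith
  simp only [this, show (a - b) ^ 2 - (a + b) ^ 2 = -4 * (a * b) by ring]

theorem integral_chiKer_mul_adjointWave (hφ : ContDiff ℝ (⊤ : ℕ∞) φ) (hs : HasCompactSupport φ)
    (s : ℝ) : ∫ p : ℝ × ℝ, chiKer p.1 (p.2 - s) * adjointWave φ p = 4 * φ (0, s) := by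
  have hφ₂ := contDiff_twistedDeriv (1, -1) hφ
  have hφ₁₂ := contDiff_twistedDeriv (1, 1) hφ₂
  have hs₂ := hasCompactSupport_twistedDeriv (1, -1) hs
  have hs₁₂ := hasCompactSupport_twistedDeriv (1, 1) hs₂
  set Ψ := charLift s φ with hΨ
  set Ψ₂ := charLift s (twistedDeriv (1, -1) φ) with hΨ₂
  set Ψ₁₂ := charLift s (twistedDeriv (1, 1) (twistedDeriv (1, -1) φ)) with hΨ₁₂
  have cΨ : ContDiff ℝ 1 Ψ := (contDiff_charLift s hφ).of_le (by exact_mod_cast le_top)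
  have cΨ₂ : ContDiff ℝ 1 Ψ₂ := (contDiff_charLift s hφ₂).of_le (by exact_mod_cast le_top)
  have cΨ₁₂ : Continuous Ψ₁₂ := continuous_charLift s hφ₁₂.continuous
  have kΨ : HasCompactSupport Ψ := hasCompactSupport_charLift s hs
  have kΨ₂ : HasCompactSupport Ψ₂ := hasCompactSupport_charLift s hs₂
  have kΨ₁₂ : HasCompactSupport Ψ₁₂ := hasCompactSupport_charLift s hs₁₂
  have d₂ : ∀ a b, HasDerivAt (fun b => Ψ (a, b)) (Ψ₂ (a, b)) b :=
    hasDerivAt_charLift_snd s (hφ.differentiable (by simp))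
  have d₁₂ : ∀ a b, HasDerivAt (fun a => Ψ₂ (a, b)) (Ψ₁₂ (a, b)) a :=
    hasDerivAt_charLift_fst s (hφ₂.differentiable (by simp))
  have hΨ0 : Ψ (0, 0) = φ (0, s) := by
    simp [hΨ, charLift, charCoord]
  set G : ℝ × ℝ → ℝ := fun p => fker (-4 * (p.1 * p.2)) * (Ψ₁₂ p - Ψ p / 4) with hG
  have c0 := continuous_fker
  have cG : Continuous G := by
    have := cΨ.continuous
    fun_prop
  have kG : HasCompactSupport G :=
    (kΨ₁₂.sub (kΨ.comp_left (g := fun x => x / 4) (zero_div 4))).mul_left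
  have iG : Integrable G := cG.integrable_of_hasCompactSupport kG
  have hpos : ∫ p in Ioi (0 : ℝ) ×ˢ Ioi (0 : ℝ), G p = φ (0, s) := by
    rw [← hΨ0]
    exact integral_quadrant_fker cΨ cΨ₂ cΨ₁₂ d₂ d₁₂ kΨ kΨ₂ kΨ₁₂
  have hneg : ∫ p in Iio (0 : ℝ) ×ˢ Iio (0 : ℝ), G p = φ (0, s) := by
    have hn : ∀ {F : ℝ × ℝ → ℝ}, HasCompactSupport F → HasCompactSupport fun p => F (-p) :=
      fun hF => hF.comp_homeomorph (Homeomorph.neg _)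
    have := integral_quadrant_fker (Ψ := fun p => Ψ (-p)) (Ψ₂ := fun p => -Ψ₂ (-p))
      (Ψ₁₂ := fun p => Ψ₁₂ (-p)) (cΨ.comp contDiff_neg) (cΨ₂.comp contDiff_neg).neg
      (cΨ₁₂.comp continuous_neg)
      (fun a b =>
        ((d₂ (-a) (-b)).comp b (hasDerivAt_neg b)).congr_deriv (mul_neg_one _))
      (fun a b =>
        ((d₁₂ (-a) (-b)).comp a (hasDerivAt_neg a)).neg.congr_deriv (by simp))
      (hn kΨ) (hn kΨ₂).neg (hn kΨ₁₂)
    rw [← hΨ0]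
    simp only [Prod.neg_mk, neg_zero] at this
    rw [← this, ← integral_indicator (measurableSet_Iio.prod measurableSet_Iio),
      ← integral_indicator (measurableSet_Ioi.prod measurableSet_Ioi), ← integral_neg_eq_self]
    refine integral_congr_ae (Eventually.of_forall fun p => ?_)
    simp [indicator, hG]
  rw [integral_comp_charCoord s]
  have hae : (fun p => chiKer (charCoord s p).1 ((charCoord s p).2 - s)
        * adjointWave φ (charCoord s p)) =ᵐ[volume]
      fun p => (Ioi (0 : ℝ) ×ˢ Ioi (0 : ℝ)).indicator G p
        + (Iio (0 : ℝ) ×ˢ Iio (0 : ℝ)).indicator G p := by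
    have hne : ∀ᵐ x : ℝ, x ≠ 0 := Measure.ae_ne volume 0
    have hne₁ : ∀ᵐ p : ℝ × ℝ, p.1 ≠ 0 := Measure.quasiMeasurePreserving_fst.ae hne
    have hne₂ : ∀ᵐ p : ℝ × ℝ, p.2 ≠ 0 := Measure.quasiMeasurePreserving_snd.ae hne
    filter_upwards [hne₁, hne₂] with p h₁ h₂
    obtain ⟨a, b⟩ := p
    rw [chiKer_charCoord, ← twistedDeriv_twistedDeriv_sub hφ]
    have hval : exp ((a + b) / 2) * fker (-4 * (a * b))
        * (twistedDeriv (1, 1) (twistedDeriv (1, -1) φ) (charCoord s (a, b))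
          - φ (charCoord s (a, b)) / 4) = G (a, b) := by
      simp only [hG, hΨ, hΨ₁₂, charLift]
      ring
    rcases lt_or_gt_of_ne h₁ with ha | ha <;> rcases lt_or_gt_of_ne h₂ with hb | hb <;>
      simp only at ha hb
    · rw [if_pos (mul_pos_of_neg_of_neg ha hb).le, hval]
      simp [indicator, ha, hb, ha.not_gt]
    · rw [if_neg (mul_neg_of_neg_of_pos ha hb).not_ge]
      simp [indicator, ha.not_gt, hb.not_gt]
    · rw [if_neg (mul_neg_of_pos_of_neg ha hb).not_ge]
      simp [indicator, ha.not_gt, hb.not_gt]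
    · rw [if_pos (mul_pos ha hb).le, hval]
      simp [indicator, ha, hb, ha.not_gt]
  rw [integral_congr_ae hae, integral_add
    (iG.indicator (measurableSet_Ioi.prod measurableSet_Ioi))
    (iG.indicator (measurableSet_Iio.prod measurableSet_Iio)),
    integral_indicator (measurableSet_Ioi.prod measurableSet_Ioi),
    integral_indicator (measurableSet_Iio.prod measurableSet_Iio), hpos, hneg]
  ring

theorem integral_etaKer_mul_adjointWave {ψ : ℝ → ℝ} (hψ : Continuous ψ)
    (hψs : HasCompactSupport ψ) (hφ : ContDiff ℝ (⊤ : ℕ∞) φ) (hs : HasCompactSupport φ) :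
    ∫ p : ℝ × ℝ, etaKer ψ p.1 p.2 * adjointWave φ p = 4 * ∫ s, ψ s * φ (0, s) := by
  have c0 := continuous_fker
  have cA := continuous_adjointWave hφ
  have kA := hasCompactSupport_adjointWave hs
  set S : Set ((ℝ × ℝ) × ℝ) := {z | (z.1.2 - z.2) ^ 2 ≤ z.1.1 ^ 2} with hS
  have mS : MeasurableSet S := (isClosed_le (by fun_prop) (by fun_prop)).measurableSet
  set K : (ℝ × ℝ) × ℝ → ℝ := fun z =>
    exp (z.1.1 / 2) * fker ((z.1.2 - z.2) ^ 2 - z.1.1 ^ 2) * (adjointWave φ z.1 * ψ z.2) with hK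
  have cK : Continuous K := by fun_prop
  have kK : HasCompactSupport K := by
    refine HasCompactSupport.mul_left (f' := fun z : (ℝ × ℝ) × ℝ => adjointWave φ z.1 * ψ z.2) ?_
    refine HasCompactSupport.intro (kA.isCompact.prod hψs.isCompact) fun z hz => ?_
    rw [mem_prod, not_and_or] at hz
    rcases hz with h | h
    · rw [image_eq_zero_of_notMem_tsupport h, zero_mul]
    · rw [image_eq_zero_of_notMem_tsupport h, mul_zero]
  have hint : Integrable (Function.uncurry fun (p : ℝ × ℝ) (s : ℝ) =>
      chiKer p.1 (p.2 - s) * ψ s * adjointWave φ p) (volume.prod volume) := by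
    refine ((cK.integrable_of_hasCompactSupport kK).indicator mS).congr
      (Eventually.of_forall fun z => ?_)
    simp only [indicator, Function.uncurry, chiKer, hS, mem_ofPred_eq, hK]
    split_ifs <;> ring
  calc ∫ p : ℝ × ℝ, etaKer ψ p.1 p.2 * adjointWave φ p
      = ∫ p : ℝ × ℝ, ∫ s, chiKer p.1 (p.2 - s) * ψ s * adjointWave φ p := by
        simp_rw [etaKer, integral_mul_const]
    _ = ∫ s, ∫ p : ℝ × ℝ, chiKer p.1 (p.2 - s) * ψ s * adjointWave φ p :=
        integral_integral_swap hint
    _ = ∫ s, 4 * (ψ s * φ (0, s)) := by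
        refine integral_congr_ae (Eventually.of_forall fun s => ?_)
        simp only
        rw [show 4 * (ψ s * φ (0, s)) = ψ s * (4 * φ (0, s)) by ring,
          ← integral_chiKer_mul_adjointWave hφ hs s, ← integral_const_mul]
        refine integral_congr_ae (Eventually.of_forall fun p => ?_)
        simp only
        ring
    _ = 4 * ∫ s, ψ s * φ (0, s) := integral_const_mul _ _

end

/-- Theorem 4.4: the class of weak entropies.  For `ψ`
continuous with compact support and `η(R,u) = ∫ χ(R,u−s) ψ(s) ds`:
(i) `∬ η (∂_RR φ − ∂_uu φ + ∂_R φ) = 4 ∫ ψ(s) φ(0,s) ds` for all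
`φ ∈ C_c^∞(ℝ²)`; in particular the integral vanishes when `φ` is supported in
`{R ≠ 0}`; (ii) `η(R,u) → 0` as `R → 0` and as `R → −∞`;
(iii) `∂_R η(R,u) → ±2 ψ(u)` as `R → 0±`. -/
theorem weak_entropies_from_kernel
    (ψ : ℝ → ℝ) (hψ : Continuous ψ) (hψs : HasCompactSupport ψ) :
    (∀ φ : ℝ × ℝ → ℝ, ContDiff ℝ (⊤ : ℕ∞) φ → HasCompactSupport φ →
      ∫ p : ℝ × ℝ, etaKer ψ p.1 p.2 *
        (deriv (fun R => deriv (fun R' => φ (R', p.2)) R) p.1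
          - deriv (fun u => deriv (fun u' => φ (p.1, u')) u) p.2
          + deriv (fun R => φ (R, p.2)) p.1)
        = 4 * ∫ s : ℝ, ψ s * φ (0, s)) ∧
    (∀ φ : ℝ × ℝ → ℝ, ContDiff ℝ (⊤ : ℕ∞) φ → HasCompactSupport φ →
      tsupport φ ⊆ {p : ℝ × ℝ | p.1 ≠ 0} →
      ∫ p : ℝ × ℝ, etaKer ψ p.1 p.2 *
        (deriv (fun R => deriv (fun R' => φ (R', p.2)) R) p.1
          - deriv (fun u => deriv (fun u' => φ (p.1, u')) u) p.2
          + deriv (fun R => φ (R, p.2)) p.1) = 0) ∧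
    (∀ u : ℝ, Tendsto (fun R => etaKer ψ R u) (𝓝 0) (𝓝 0)) ∧
    (∀ u : ℝ, Tendsto (fun R => etaKer ψ R u) atBot (𝓝 0)) ∧
    (∀ u : ℝ, Tendsto (fun R => deriv (fun R' => etaKer ψ R' u) R)
      (𝓝[>] 0) (𝓝 (2 * ψ u))) ∧
    (∀ u : ℝ, Tendsto (fun R => deriv (fun R' => etaKer ψ R' u) R)
      (𝓝[<] 0) (𝓝 (-2 * ψ u))) := by
  have hdist : ∀ φ : ℝ × ℝ → ℝ, ContDiff ℝ (⊤ : ℕ∞) φ → HasCompactSupport φ →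
      ∫ p : ℝ × ℝ, etaKer ψ p.1 p.2 *
        (deriv (fun R => deriv (fun R' => φ (R', p.2)) R) p.1
          - deriv (fun u => deriv (fun u' => φ (p.1, u')) u) p.2
          + deriv (fun R => φ (R, p.2)) p.1)
        = 4 * ∫ s : ℝ, ψ s * φ (0, s) := fun φ hφ hs => by
    simp_rw [adjointWave_eq_deriv hφ]
    exact integral_etaKer_mul_adjointWave hψ hψs hφ hs
  refine ⟨hdist, fun φ hφ hs hsupp => ?_, tendsto_etaKer_zero hψ, tendsto_etaKer_atBot hψ hψs,
    tendsto_deriv_etaKer_right hψ, tendsto_deriv_etaKer_left hψ⟩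
  have h0 : ∀ s, φ (0, s) = 0 := fun s =>
    image_eq_zero_of_notMem_tsupport fun h => hsupp h rfl
  rw [hdist φ hφ hs]
  simp [h0]
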